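/- Let T>0, let b∈C¹([0,T]) be nonnegative, let a∈𝒢^s(ℝ) (s>1) be nonnegative and let 0≤δ<1. Then there exist A>0 and C>0, independent of μ∈(0,1] and t∈[0,T], such that for all i,j∈ℕ, t∈[0,T], x,ξ∈ℝ and 0<μ≤1: |∂_ξ^{i}∂_x^{j}e^{-Λ(t,x,ξ)}| ≤ C·A^{i+j}·((i+j)+(i+j)^{s}⟨ξ⟩_μ^{-δ})^{i+j}·⟨ξ⟩_μ^{-i+δj}. -/

import Mathlib

open scoped ContDiff

open Set

/-- `⟨ξ⟩_μ = (μ⁻² + ξ²)^(1/2)` -/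
noncomputable def br (μ ξ : ℝ) : ℝ := Real.sqrt (μ⁻¹ ^ 2 + ξ ^ 2)

/-- `φ(x,ξ) = a(x) + ⟨ξ⟩_μ^(-2δ)` -/
noncomputable def phi (a : ℝ → ℝ) (δ μ x ξ : ℝ) : ℝ := a x + br μ ξ ^ (-(2*δ))

/-- Gevrey class `𝒢^s(ℝ)` -/
def Gevrey (s : ℝ) (a : ℝ → ℝ) : Prop :=
  ContDiff ℝ ∞ a ∧ ∃ C₀ A₀ : ℝ, 0 < C₀ ∧ 0 < A₀ ∧
    ∀ (x : ℝ) (k : ℕ), |iteratedDeriv k a x| ≤ C₀ * A₀ ^ k * (k.factorial : ℝ) ^ s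

/-- `∂_ξ^i ∂_x^j f(x,ξ)` -/
noncomputable def pdXiX (i j : ℕ) (f : ℝ → ℝ → ℝ) (x ξ : ℝ) : ℝ :=
  iteratedDeriv i (fun ξ' => iteratedDeriv j (fun x' => f x' ξ') x) ξ

/-- `Λ(t,x,ξ) = ∫₀ᵗ |b'(σ)| φ(x,ξ) / (b(σ) φ(x,ξ) + ⟨ξ⟩_μ^(-2δ)) dσ`,
with `b'` the derivative of `b` within `[0,T]`. -/
noncomputable def Lam (b a : ℝ → ℝ) (T δ μ t x ξ : ℝ) : ℝ :=
  ∫ σ in (0:ℝ)..t,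
    |derivWithin b (Icc 0 T) σ| * phi a δ μ x ξ /
      (b σ * phi a δ μ x ξ + br μ ξ ^ (-(2*δ)))


lemma cast_iter {U : Set ℂ} (hU : IsOpen U) {F : ℂ → ℂ} (hF : DifferentiableOn ℂ F U)
    {h : ℝ → ℝ} (hFh : ∀ y : ℝ, (y : ℂ) ∈ U → F y = h y) (k : ℕ) :
    DifferentiableOn ℂ (iteratedDeriv k F) U ∧
      ∀ y : ℝ, (y : ℂ) ∈ U → iteratedDeriv k F y = ((iteratedDeriv k h y : ℝ) : ℂ) := by
  induction k with
  | zero => simpa using ⟨hF, hFh⟩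
  | succ k ih =>
    obtain ⟨ih1, ih2⟩ := ih
    refine ⟨by rw [iteratedDeriv_succ]; exact ih1.deriv hU, fun y hy => ?_⟩
    rw [iteratedDeriv_succ, iteratedDeriv_succ]
    have hd : HasDerivAt (iteratedDeriv k F) (deriv (iteratedDeriv k F) y) y :=
      (ih1.differentiableAt (hU.mem_nhds hy)).hasDerivAt
    have hev : ∀ᶠ y' : ℝ in nhds y, ((y' : ℝ) : ℂ) ∈ U :=
      (Complex.continuous_ofReal.continuousAt (x := y)).eventually (hU.mem_nhds hy)
    have h1 : HasDerivAt (fun y : ℝ => ((iteratedDeriv k h y : ℝ) : ℂ))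
        (deriv (iteratedDeriv k F) y) y :=
      hd.comp_ofReal.congr_of_eventuallyEq (hev.mono fun y' hy' => (ih2 y' hy').symm)
    have h2 : HasDerivAt (iteratedDeriv k h) (deriv (iteratedDeriv k F) y).re y :=
      hd.real_of_complex.congr_of_eventuallyEq (hev.mono fun y' hy' => by
        show iteratedDeriv k h y' = (iteratedDeriv k F y').re
        rw [ih2 y' hy']; simp)
    rw [h2.deriv]
    exact h1.unique h2.ofReal_comp

lemma cast_contDiffAt {U : Set ℂ} (hU : IsOpen U) {F : ℂ → ℂ} (hF : DifferentiableOn ℂ F U)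
    {h : ℝ → ℝ} (hFh : ∀ y : ℝ, (y : ℂ) ∈ U → F y = h y) (y : ℝ) (hy : (y:ℂ) ∈ U) (n : ℕ∞) :
    ContDiffAt ℝ n h y := by
  have h1 : ContDiffAt ℂ n F y := (hF.analyticAt (hU.mem_nhds hy)).contDiffAt
  have hev : ∀ᶠ y' : ℝ in nhds y, ((y' : ℝ) : ℂ) ∈ U :=
      (Complex.continuous_ofReal.continuousAt (x := y)).eventually (hU.mem_nhds hy)
  refine h1.real_of_complex.congr_of_eventuallyEq (hev.mono fun y' hy' => ?_)
  show h y' = (F y').re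
  rw [hFh y' hy']; simp

noncomputable def jet (n : ℕ) (x r : ℝ) (f : ℝ → ℝ) : ℝ :=
  ∑ k ∈ Finset.range (n+1), |iteratedDeriv k f x| * r ^ k / (k.factorial : ℝ)

lemma jet_nonneg (n : ℕ) (x r : ℝ) (hr : 0 ≤ r) (f : ℝ → ℝ) : 0 ≤ jet n x r f :=
  Finset.sum_nonneg fun k _ => by positivity

lemma jet_mul (n : ℕ) (x r : ℝ) (hr : 0 ≤ r) (f g : ℝ → ℝ) (hf : ContDiff ℝ ∞ f)
    (hg : ContDiff ℝ ∞ g) : jet n x r (f * g) ≤ jet n x r f * jet n x r g := by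
  set u : ℕ → ℝ := fun k => |iteratedDeriv k f x| * r ^ k / (k.factorial : ℝ) with hu
  set w : ℕ → ℝ := fun k => |iteratedDeriv k g x| * r ^ k / (k.factorial : ℝ) with hw
  have hu0 : ∀ k, 0 ≤ u k := fun k => by simp only [hu]; positivity
  have hw0 : ∀ k, 0 ≤ w k := fun k => by simp only [hw]; positivity
  have step : ∀ m, |iteratedDeriv m (f*g) x| * r ^ m / (m.factorial : ℝ) ≤
      ∑ p ∈ Finset.HasAntidiagonal.antidiagonal m, u p.1 * w p.2 := by
    intro m
    rw [iteratedDeriv_mul (hf.contDiffAt.of_le (by exact_mod_cast le_top)) (hg.contDiffAt.of_le (by exact_mod_cast le_top)),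
      Finset.Nat.sum_antidiagonal_eq_sum_range_succ (fun p q => u p * w q)]
    calc _ ≤ (∑ p ∈ Finset.range (m+1), |(m.choose p : ℝ) * iteratedDeriv p f x * iteratedDeriv (m-p) g x|) * r^m / (m.factorial:ℝ) := by
          gcongr; exact Finset.abs_sum_le_sum_abs _ _
      _ = _ := by
          rw [Finset.sum_mul, Finset.sum_div]
          refine Finset.sum_congr rfl fun p hp => ?_
          have hpm : p ≤ m := by simpa [Nat.lt_succ_iff] using hp
          rw [abs_mul, abs_mul, Nat.abs_cast, Nat.cast_choose ℝ hpm]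
          simp only [hu, hw]
          have : r^m = r^p * r^(m-p) := by rw [← pow_add]; congr 1; omega
          rw [this]
          field_simp
  unfold jet
  calc _ ≤ ∑ m ∈ Finset.range (n+1), ∑ p ∈ Finset.HasAntidiagonal.antidiagonal m, u p.1 * w p.2 :=
        Finset.sum_le_sum fun m _ => step m
    _ = ∑ q ∈ (Finset.range (n+1)).sigma (fun m => Finset.HasAntidiagonal.antidiagonal m), u q.2.1 * w q.2.2 := by
        rw [Finset.sum_sigma]
    _ = ∑ p ∈ ((Finset.range (n+1)).sigma (fun m => Finset.HasAntidiagonal.antidiagonal m)).image (fun q => q.2), u p.1 * w p.2 := by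
        rw [Finset.sum_image]
        rintro ⟨m, p⟩ h1 ⟨m', p'⟩ h2 h
        simp at h1 h2 h
        obtain ⟨_, rfl⟩ := h1
        obtain ⟨_, rfl⟩ := h2
        subst h
        rfl
    _ ≤ ∑ p ∈ (Finset.range (n+1)) ×ˢ (Finset.range (n+1)), u p.1 * w p.2 := by
        apply Finset.sum_le_sum_of_subset_of_nonneg
        · rintro ⟨p1, p2⟩ h
          simp at h ⊢
          omega
        · intro p _ _; exact mul_nonneg (hu0 _) (hw0 _)
    _ = _ := by rw [Finset.sum_product, Finset.sum_mul_sum]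

lemma jet_pow (n : ℕ) (x r : ℝ) (hr : 0 ≤ r) (f : ℝ → ℝ) (hf : ContDiff ℝ ∞ f) (k : ℕ) :
    jet n x r (fun y => f y ^ k) ≤ jet n x r f ^ k := by
  induction k with
  | zero =>
    simp only [pow_zero, jet, Finset.sum_range_succ', iteratedDeriv_zero]
    rw [Finset.sum_eq_zero]
    · simp
    · intro m _; simp [iteratedDeriv_const]
  | succ k ih =>
    have : (fun y => f y ^ (k+1)) = (fun y => f y ^ k) * f := by ext y; simp [pow_succ]
    rw [this, pow_succ]
    exact (jet_mul n x r hr _ _ (hf.pow k) hf).trans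
      (mul_le_mul_of_nonneg_right ih (jet_nonneg n x r hr f))

lemma iter_le_jet (n : ℕ) (x r : ℝ) (hr : 0 ≤ r) (f : ℝ → ℝ) :
    |iteratedDeriv n f x| * r ^ n / (n.factorial : ℝ) ≤ jet n x r f := by
  refine Finset.single_le_sum (f := fun k => |iteratedDeriv k f x| * r ^ k / (k.factorial : ℝ))
    (fun k _ => by positivity) (by simp)

lemma vanish_comp (n : ℕ) {R f : ℝ → ℝ} {t : Set ℝ} (ht : IsOpen t) (hR : ContDiffOn ℝ n R t)
    (hf : ContDiff ℝ n f) (hft : range f ⊆ t) (x : ℝ)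
    (h0 : ∀ k ≤ n, iteratedDeriv k R (f x) = 0) : iteratedDeriv n (R ∘ f) x = 0 := by
  have hx : f x ∈ t := hft ⟨x, rfl⟩
  set D : ℝ := 1 + ∑ i ∈ Finset.range (n+1), ‖iteratedFDeriv ℝ i f x‖ with hD
  have hD1 : 1 ≤ D := by
    have : 0 ≤ ∑ i ∈ Finset.range (n+1), ‖iteratedFDeriv ℝ i f x‖ := by positivity
    linarith
  have := norm_iteratedFDeriv_comp_le' (C := 0) (D := D) hft ht.uniqueDiffOn hR hf le_rfl x
    (fun i hi => by
      rw [norm_iteratedFDerivWithin_eq_norm_iteratedDerivWithin,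
        iteratedDerivWithin_of_isOpen ht hx, h0 i hi, norm_zero])
    (fun i hi hi' => by
      have h1 : ‖iteratedFDeriv ℝ i f x‖ ≤ ∑ i ∈ Finset.range (n+1), ‖iteratedFDeriv ℝ i f x‖ :=
        Finset.single_le_sum (f := fun i => ‖iteratedFDeriv ℝ i f x‖) (fun _ _ => norm_nonneg _) (by simp; omega)
      have h2 : D ≤ D ^ i := le_self_pow₀ hD1 (by omega)
      linarith)
  rw [norm_iteratedFDeriv_eq_norm_iteratedDeriv] at this
  simpa using this

lemma iter_shift_pow (k m : ℕ) (c : ℝ) :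
    iteratedDeriv k (fun y : ℝ => (y - c)^m) c = if k = m then (m.factorial : ℝ) else 0 := by
  have := congrFun (iteratedDeriv_comp_sub_const (𝕜 := ℝ) k (fun y : ℝ => y^m) c) c
  rw [this, sub_self, iteratedDeriv_fun_pow_zero]; push_cast; rfl
  
lemma iter_sum (n m : ℕ) (c : ℕ → ℝ) (f : ℕ → ℝ → ℝ) (x : ℝ) (hf : ∀ k, ContDiff ℝ ∞ (f k)) :
    iteratedDeriv n (fun y => ∑ k ∈ Finset.range m, c k * f k y) x =
      ∑ k ∈ Finset.range m, c k * iteratedDeriv n (f k) x := by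
  induction m with
  | zero => simp
  | succ m ih =>
    simp only [Finset.sum_range_succ]
    rw [iteratedDeriv_fun_add, ih, iteratedDeriv_const_mul_field]
    · exact ContDiff.contDiffAt ((ContDiff.sum fun k _ => contDiff_const.mul (hf k)).of_le (by exact_mod_cast le_top))
    · exact ContDiff.contDiffAt ((contDiff_const.mul (hf m)).of_le (by exact_mod_cast le_top))

lemma taylor_comp (n : ℕ) {F f : ℝ → ℝ} {t : Set ℝ} (ht : IsOpen t) (hF : ContDiffOn ℝ n F t)
    (hf : ContDiff ℝ ∞ f) (hft : range f ⊆ t) (x : ℝ) :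
    iteratedDeriv n (fun y => F (f y)) x = ∑ k ∈ Finset.range (n+1),
      (iteratedDeriv k F (f x) / (k.factorial : ℝ)) * iteratedDeriv n (fun y => (f y - f x)^k) x := by
  have hx : f x ∈ t := hft ⟨x, rfl⟩
  have hle : (n : ℕ∞ω) ≤ ∞ := by exact_mod_cast le_top
  set P : ℝ → ℝ := fun v => ∑ k ∈ Finset.range (n+1), (iteratedDeriv k F (f x) / (k.factorial : ℝ)) * (v - f x)^k with hP
  have hPs : ContDiff ℝ ∞ P := ContDiff.sum fun k _ => by fun_prop
  have hR := vanish_comp n (R := fun v => F v - P v) ht (hF.sub (hPs.of_le hle).contDiffOn) (hf.of_le hle) hft x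
    (fun k hk => by
      rw [iteratedDeriv_fun_sub, hP, iter_sum]
      · simp only [iter_shift_pow]
        rw [Finset.sum_eq_single k]
        · simp; field_simp; simp
        · intro b _ hb; simp [Ne.symm hb]
        · intro h; simp at h; omega
      · intro k; fun_prop
      · exact (hF.contDiffAt (ht.mem_nhds hx)).of_le (by exact_mod_cast hk)
      · exact (hPs.of_le (by exact_mod_cast le_top)).contDiffAt)
  have hFf : ContDiffAt ℝ n (fun y => F (f y)) x :=
    ContDiffAt.comp x (hF.contDiffAt (ht.mem_nhds hx)) (hf.of_le hle).contDiffAt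
  have hPf : ContDiffAt ℝ n (fun y => P (f y)) x := ((hPs.comp hf).of_le hle).contDiffAt
  have e : ((fun v => F v - P v) ∘ f) = fun y => F (f y) - P (f y) := rfl
  rw [e, iteratedDeriv_fun_sub hFf hPf, sub_eq_zero] at hR
  rw [hR]
  exact iter_sum n (n+1) _ (fun k y => (f y - f x)^k) x (fun k => by fun_prop)

/-- complex extension -/
noncomputable def HC (β b : ℝ → ℝ) (t : ℝ) (v : ℂ) : ℂ :=
  Complex.exp (-∫ σ in (0:ℝ)..t, (β σ : ℂ) * (v / (b σ * v + 1)))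

lemma one_le_norm_den {b : ℝ} (hb : 0 ≤ b) {v : ℂ} (hv : 0 < v.re) : 1 ≤ ‖(b : ℂ) * v + 1‖ := by
  have h := Complex.re_le_norm ((b:ℂ) * v + 1)
  simp at h
  nlinarith

lemma den_ne {b : ℝ} (hb : 0 ≤ b) {v : ℂ} (hv : 0 < v.re) : (b : ℂ) * v + 1 ≠ 0 := by
  intro h
  have := one_le_norm_den hb hv
  rw [h, norm_zero] at this
  linarith

lemma re_quot {b : ℝ} (hb : 0 ≤ b) {v : ℂ} (hv : 0 < v.re) : 0 ≤ (v / ((b : ℂ) * v + 1)).re := by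
  rw [Complex.div_re, ← add_div]
  apply div_nonneg _ (Complex.normSq_nonneg _)
  simp
  nlinarith [mul_nonneg hb (sq_nonneg v.re), mul_nonneg hb (sq_nonneg v.im)]

section
variable {β b : ℝ → ℝ} {t : ℝ} 

lemma HC_int (ht : 0 ≤ t) (hβ : ContinuousOn β (Icc 0 t)) (hb : ContinuousOn b (Icc 0 t))
    (hb0 : ∀ σ ∈ Icc 0 t, 0 ≤ b σ) {v : ℂ} (hv : 0 < v.re) :
    IntervalIntegrable (fun σ => (β σ : ℂ) * (v / (b σ * v + 1))) MeasureTheory.volume 0 t := by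
  apply ContinuousOn.intervalIntegrable
  rw [uIcc_of_le ht]
  have h1 : ContinuousOn (fun σ => (β σ : ℂ)) (Icc 0 t) := Complex.continuous_ofReal.comp_continuousOn hβ
  have h2 : ContinuousOn (fun σ => (b σ : ℂ)) (Icc 0 t) := Complex.continuous_ofReal.comp_continuousOn hb
  exact h1.mul (continuousOn_const.div ((h2.mul continuousOn_const).add continuousOn_const)
    fun σ hσ => den_ne (hb0 σ hσ) hv)

lemma HC_diff (ht : 0 ≤ t) (hβ : ContinuousOn β (Icc 0 t)) (hb : ContinuousOn b (Icc 0 t))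
    (hb0 : ∀ σ ∈ Icc 0 t, 0 ≤ b σ) : DifferentiableOn ℂ (HC β b t) {v : ℂ | 0 < v.re} := by
  intro v hv
  have hop : IsOpen {v : ℂ | 0 < v.re} := isOpen_lt continuous_const Complex.continuous_re
  have hI : uIoc 0 t ⊆ Icc 0 t := by rw [uIoc_of_le ht]; exact Ioc_subset_Icc_self
  have h1 : ContinuousOn (fun σ => (β σ : ℂ)) (Icc 0 t) := Complex.continuous_ofReal.comp_continuousOn hβ
  have h2 : ContinuousOn (fun σ => (b σ : ℂ)) (Icc 0 t) := Complex.continuous_ofReal.comp_continuousOn hb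
  have key := intervalIntegral.hasDerivAt_integral_of_dominated_loc_of_deriv_le
    (μ := MeasureTheory.volume) (a := 0) (b := t) (x₀ := v) (s := {v : ℂ | 0 < v.re})
    (F := fun v σ => (β σ : ℂ) * (v / (b σ * v + 1)))
    (F' := fun v σ => (β σ : ℂ) * (1 / (b σ * v + 1)^2)) (bound := fun σ => |β σ|)
    (hop.mem_nhds hv)
    (Filter.eventually_of_mem (hop.mem_nhds hv) fun v' hv' =>
      ((intervalIntegrable_iff.1 (HC_int ht hβ hb hb0 hv')).aestronglyMeasurable))
    (HC_int ht hβ hb hb0 hv)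
    ((intervalIntegrable_iff.1 (ContinuousOn.intervalIntegrable (by
      rw [uIcc_of_le ht]
      exact h1.mul (continuousOn_const.div (((h2.mul continuousOn_const).add continuousOn_const).pow 2)
        fun σ hσ => pow_ne_zero 2 (den_ne (hb0 σ hσ) hv))))).aestronglyMeasurable)
    (Filter.Eventually.of_forall fun σ hσ v' hv' => by
      have := one_le_norm_den (hb0 σ (hI hσ)) hv'
      rw [norm_mul, norm_div, norm_pow, norm_one, Complex.norm_real, Real.norm_eq_abs]
      apply mul_le_of_le_one_right (abs_nonneg _)
      rw [div_le_one (by positivity)]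
      exact one_le_pow₀ this)
    (ContinuousOn.intervalIntegrable (by rw [uIcc_of_le ht]; exact hβ.abs))
    (Filter.Eventually.of_forall fun σ hσ v' hv' => by
      have hne := den_ne (hb0 σ (hI hσ)) hv'
      have hd : HasDerivAt (fun v : ℂ => (b σ : ℂ) * v + 1) (b σ) v' := by
        simpa using ((hasDerivAt_id v').const_mul (b σ : ℂ)).add_const 1
      have h3 := ((hasDerivAt_id' v').div hd hne).const_mul (β σ : ℂ)
      have e : (1:ℂ) = 1 * ((b σ : ℂ) * v' + 1) - v' * (b σ : ℂ) := by ring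
      have h4 : HasDerivAt (fun v : ℂ => (β σ : ℂ) * (v / (b σ * v + 1)))
        ((β σ : ℂ) * ((1 * ((b σ : ℂ) * v' + 1) - v' * (b σ : ℂ)) / ((b σ : ℂ) * v' + 1)^2)) v' := h3
      rwa [← e] at h4)
  exact (key.2.neg.cexp).differentiableAt.differentiableWithinAt

lemma HC_norm (ht : 0 ≤ t) (hβ : ContinuousOn β (Icc 0 t)) (hb : ContinuousOn b (Icc 0 t))
    (hb0 : ∀ σ ∈ Icc 0 t, 0 ≤ b σ) (hβ0 : ∀ σ, 0 ≤ β σ) {v : ℂ} (hv : 0 < v.re) : ‖HC β b t v‖ ≤ 1 := by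
  rw [HC, Complex.norm_exp]
  apply Real.exp_le_one_iff.2
  rw [Complex.neg_re, neg_nonpos]
  have := Complex.reCLM.intervalIntegral_comp_comm (HC_int ht hβ hb hb0 hv)
  simp only [Complex.reCLM_apply] at this
  rw [← this]
  apply intervalIntegral.integral_nonneg ht
  intro σ hσ
  rw [Complex.re_ofReal_mul]
  exact mul_nonneg (hβ0 σ) (re_quot (hb0 σ hσ) hv)

lemma HC_real (y : ℝ) :
    HC β b t y = ((Real.exp (-∫ σ in (0:ℝ)..t, β σ * (y / (b σ * y + 1))) : ℝ) : ℂ) := by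
  rw [HC, Complex.ofReal_exp, Complex.ofReal_neg, ← intervalIntegral.integral_ofReal]
  push_cast
  rfl
end

lemma glaeser {a : ℝ → ℝ} (ha : ContDiff ℝ ∞ a) (ha0 : ∀ x, 0 ≤ a x) {K : ℝ} (hK : 0 < K)
    (h2 : ∀ x, |iteratedDeriv 2 a x| ≤ K) (x : ℝ) : (iteratedDeriv 1 a x)^2 ≤ 2 * K * a x := by
  by_cases hd : iteratedDeriv 1 a x = 0
  · rw [hd]; have := mul_nonneg (mul_nonneg zero_le_two hK.le) (ha0 x); simpa using this
  have key : ∀ y, x ≠ y → a y ≤ a x + iteratedDeriv 1 a x * (y - x) + K * (y-x)^2 / 2 := by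
    intro y hxy
    obtain ⟨z, _, hz⟩ := taylor_mean_remainder_lagrange_iteratedDeriv (f := a) (n := 1) hxy
      (contDiff_infty.1 ha 2).contDiffOn
    have hdw : derivWithin a (uIcc x y) x = deriv a x :=
      (ha.differentiable (by simp) x).derivWithin (uniqueDiffOn_uIcc hxy x left_mem_uIcc)
    rw [taylorWithinEval_succ, taylor_within_zero_eval, iteratedDerivWithin_one, hdw] at hz
    rw [iteratedDeriv_one]
    norm_num at hz
    have h3 := (abs_le.1 (h2 z)).2
    have h4 : iteratedDeriv 2 a z * (y-x)^2 ≤ K * (y-x)^2 := by gcongr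
    nlinarith
  set d := iteratedDeriv 1 a x with hdd
  have h := key (x - d / K) (by
    intro h
    have : d / K = 0 := by linarith
    rw [div_eq_zero_iff] at this
    rcases this with h | h
    · exact hd h
    · exact hK.ne' h)
  have h0 := ha0 (x - d/K)
  have e : a x + d * (x - d/K - x) + K * (x - d/K - x)^2/2 = a x - d^2/(2*K) := by
    field_simp; ring
  rw [e] at h
  have : d^2/(2*K) ≤ a x := by linarith
  rw [div_le_iff₀ (by positivity)] at this
  linarith

lemma geo_le {q : ℝ} (h0 : 0 ≤ q) (h1 : q ≤ 1/2) (n : ℕ) : ∑ k ∈ Finset.range n, q^k ≤ 2 := by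
  have h := mul_neg_geom_sum q n
  have h2 : 0 ≤ q^n := by positivity
  have h3 : 0 ≤ ∑ k ∈ Finset.range n, q^k := by positivity
  nlinarith

lemma fact_bound (m N : ℕ) (h : m + 2 ≤ N) : (m+2).factorial ≤ 4^(m+2) * N^m := by
  have h1 : m.factorial ≤ N^m := (Nat.factorial_le_pow m).trans (Nat.pow_le_pow_left (by omega) m)
  have h2 : m + 2 ≤ 2^(m+2) := Nat.lt_two_pow_self.le
  have h3 : m + 1 ≤ 2^(m+2) := by omega
  calc (m+2).factorial = (m+2) * (m+1) * m.factorial := by rw [Nat.factorial_succ, Nat.factorial_succ]; ring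
    _ ≤ 2^(m+2) * 2^(m+2) * N^m := by gcongr
    _ = _ := by rw [← mul_pow]; norm_num

lemma fact_bound' {s : ℝ} (hs : 1 < s) (m N : ℕ) (h : m + 2 ≤ N) {ρ : ℝ} (hρ : 0 < ρ) :
    ((m+2).factorial : ℝ)^(s-1) * ρ^m ≤ (4^(s-1))^(m+2) * (1 + (N:ℝ)^(s-1) * ρ)^(m+2) := by
  have h0 : (0:ℝ) ≤ (N:ℝ)^(s-1) * ρ := by positivity
  have h1 : ((m+2).factorial : ℝ) ≤ (4:ℝ)^(m+2) * (N:ℝ)^m := by exact_mod_cast fact_bound m N h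
  calc ((m+2).factorial : ℝ)^(s-1) * ρ^m ≤ ((4:ℝ)^(m+2) * (N:ℝ)^m)^(s-1) * ρ^m := by gcongr
    _ = (4^(s-1))^(m+2) * ((N:ℝ)^(s-1) * ρ)^m := by
      rw [Real.mul_rpow (by positivity) (by positivity), ← Real.rpow_pow_comm (by norm_num),
        ← Real.rpow_pow_comm (by positivity), mul_pow]
      ring
    _ ≤ (4^(s-1))^(m+2) * (1 + (N:ℝ)^(s-1) * ρ)^m := by gcongr; linarith
    _ ≤ _ := by gcongr <;> linarith

lemma jet_gevrey {s : ℝ} (hs : 1 < s) {a : ℝ → ℝ} (ha : Gevrey s a) (ha0 : ∀ x, 0 ≤ a x) :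
    ∃ c : ℝ, 0 < c ∧ ∀ (n N : ℕ) (x ρ : ℝ), n ≤ N → 0 < ρ →
      jet n x (c * ρ / (1 + (N:ℝ)^(s-1) * ρ)) (fun y => a y - a x) ≤ (a x + ρ^2) / 12 := by
  obtain ⟨hac, C, A, hC, hA, hb⟩ := ha
  set K := C * A^2 * ((2:ℕ).factorial : ℝ)^s with hK
  have hK0 : 0 < K := by positivity
  have hgl := glaeser hac ha0 hK0 (fun x => hb x 2)
  set B := A * 4^(s-1) + 1 with hB
  have hB1 : 1 ≤ B := by have : 0 < A * 4^(s-1) := by positivity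
                         linarith
  set K' := C + 2*K + 1 with hK'
  have hK1 : 1 ≤ K' := by linarith
  have hc0 : 0 < 1 / (24 * K' * B) := by positivity
  refine ⟨1 / (24*K'*B), hc0, ?_⟩
  intro n N x ρ hn hρ
  set c := 1 / (24*K'*B) with hc
  have hBc : B * c = 1/(24*K') := by rw [hc]; field_simp
  set M := 1 + (N:ℝ)^(s-1) * ρ with hM
  have hM1 : 1 ≤ M := by have : 0 ≤ (N:ℝ)^(s-1) * ρ := by positivity
                         linarith
  have hM0 : 0 < M := by linarith
  have hφ : 0 ≤ a x + ρ^2 := by have := ha0 x; positivity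
  have term : ∀ k, k < n → |iteratedDeriv (k+1) a x| * (c*ρ/M)^(k+1) / ((k+1).factorial : ℝ) ≤
      (a x + ρ^2) * K' * (B*c) * (B*c)^k := by
    intro k hk
    rcases k with _ | m
    · simp only [zero_add, pow_one, pow_zero, mul_one, Nat.factorial_one, Nat.cast_one, div_one]
      have h1 := hgl x
      rw [← sq_abs] at h1
      set d := |iteratedDeriv 1 a x|
      have hd0 : 0 ≤ d := abs_nonneg _
      have h2 : d * ρ ≤ (a x + ρ^2) * K' := by
        nlinarith [sq_nonneg (d - ρ), ha0 x, sq_nonneg ρ, mul_nonneg hC.le (ha0 x), mul_nonneg hC.le (sq_nonneg ρ),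
          mul_nonneg hK0.le (ha0 x), mul_nonneg hK0.le (sq_nonneg ρ)]
      calc d * (c*ρ/M) ≤ d * (c * ρ) := by gcongr; exact div_le_self (by positivity) hM1
        _ = d * ρ * (1 * c) := by ring
        _ ≤ _ := by gcongr
    · have hmN : m + 2 ≤ N := by omega
      have hf := fact_bound' hs m N hmN hρ
      rw [← hM] at hf
      have hfac : (0:ℝ) < ((m+2).factorial : ℝ) := by positivity
      have e1 : ((m+2).factorial : ℝ)^s = ((m+2).factorial : ℝ)^(s-1) * ((m+2).factorial : ℝ) := by
        rw [← Real.rpow_add_one hfac.ne']; congr 1; ring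
      show |iteratedDeriv (m+2) a x| * (c*ρ/M)^(m+2) / ((m+2).factorial : ℝ) ≤ _
      calc _ ≤ (C * A^(m+2) * ((m+2).factorial : ℝ)^s) * (c*ρ/M)^(m+2) / ((m+2).factorial : ℝ) := by
            gcongr; exact hb x (m+2)
        _ = C * (A*c)^(m+2) * ρ^2 * (((m+2).factorial : ℝ)^(s-1) * ρ^m) / M^(m+2) := by
            rw [e1, div_pow, mul_pow, mul_pow, pow_add ρ m 2]; field_simp
        _ ≤ C * (A*c)^(m+2) * ρ^2 * ((4^(s-1))^(m+2) * M^(m+2)) / M^(m+2) := by gcongr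
        _ = ρ^2 * C * ((A * 4^(s-1)) * c)^(m+2) := by
            rw [mul_right_comm A, mul_pow (A*c)]; field_simp
        _ ≤ (a x + ρ^2) * K' * (B*c)^(m+2) := by
            gcongr
            · linarith [ha0 x]
            · linarith
            · linarith
        _ = _ := by ring
  have q0 : 0 ≤ B * c := by positivity
  have q1 : B * c ≤ 1/2 := by
    rw [hBc, div_le_div_iff₀ (by positivity) (by norm_num)]; linarith
  unfold jet
  rw [Finset.sum_range_succ']
  have e0 : |iteratedDeriv 0 (fun y => a y - a x) x| = 0 := by simp
  rw [e0]
  simp only [zero_mul, zero_div, add_zero]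
  have ed : ∀ k, iteratedDeriv (k+1) (fun y => a y - a x) x = iteratedDeriv (k+1) a x := by
    intro k
    rw [iteratedDeriv_succ', iteratedDeriv_succ']
    congr 1; ext y; simp
  calc _ ≤ ∑ k ∈ Finset.range n, (a x + ρ^2) * K' * (B*c) * (B*c)^k := by
        refine Finset.sum_le_sum fun k hk => ?_
        rw [ed]; exact term k (by simpa using hk)
    _ = (a x + ρ^2) * K' * (B*c) * ∑ k ∈ Finset.range n, (B*c)^k := by rw [Finset.mul_sum]
    _ ≤ (a x + ρ^2) * K' * (B*c) * 2 := by gcongr; exact geo_le q0 q1 n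
    _ = _ := by rw [hBc]; field_simp; ring

lemma br_pos {μ : ℝ} (hμ : 0 < μ) (ξ : ℝ) : 0 < br μ ξ := Real.sqrt_pos.2 (by positivity)

lemma br_sq {μ : ℝ} (ξ : ℝ) : br μ ξ ^ 2 = μ⁻¹ ^ 2 + ξ ^ 2 := Real.sq_sqrt (by positivity)

lemma abs_le_br {μ : ℝ} (ξ : ℝ) : |ξ| ≤ br μ ξ :=
  Real.abs_le_sqrt (by nlinarith [sq_nonneg μ⁻¹])

lemma gext (δ : ℝ) : ∃ c : ℝ, 0 < c ∧ ∀ μ ξ₀ : ℝ, 0 < μ → ∃ g : ℂ → ℂ,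
    DifferentiableOn ℂ g (Metric.ball (ξ₀ : ℂ) (2 * (c * br μ ξ₀))) ∧
    (∀ ζ ∈ Metric.ball (ξ₀ : ℂ) (2 * (c * br μ ξ₀)), ‖g ζ‖ ≤ 3/2 * br μ ξ₀ ^ (2*δ) ∧
      br μ ξ₀ ^ (2*δ) / 2 ≤ (g ζ).re) ∧
    (∀ ξ : ℝ, (ξ : ℂ) ∈ Metric.ball (ξ₀ : ℂ) (2 * (c * br μ ξ₀)) →
      g ξ = ((br μ ξ ^ (2*δ) : ℝ) : ℂ)) := by
  have hcont : ContinuousAt (fun τ : ℂ => (1 + τ) ^ (δ : ℂ)) 0 := by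
    apply ContinuousAt.cpow (by fun_prop) (by fun_prop)
    simp
  obtain ⟨ε, hε, hb⟩ := Metric.continuousAt_iff.1 hcont (1/2) (by norm_num)
  simp only [dist_zero_right, add_zero, Complex.one_cpow, dist_eq_norm, sub_zero] at hb
  set c := min ε 1 / 16 with hc
  have hm : 0 < min ε 1 := lt_min hε one_pos
  have hc0 : 0 < c := by positivity
  refine ⟨c, hc0, fun μ ξ₀ hμ => ?_⟩
  have hB := br_pos hμ ξ₀
  set B := br μ ξ₀ with hBd
  have hτ : ∀ ζ ∈ Metric.ball (ξ₀ : ℂ) (2 * (c * B)), ‖(ζ^2 - (ξ₀:ℂ)^2) / ((B^2 : ℝ) : ℂ)‖ < min ε 1 := by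
    intro ζ hζ
    rw [mem_ball_iff_norm] at hζ
    have h1 : ‖ζ + ξ₀‖ ≤ 4 * B := by
      have : ζ + ξ₀ = (ζ - ξ₀) + ((2 * ξ₀ : ℝ) : ℂ) := by push_cast; ring
      rw [this]
      refine (norm_add_le _ _).trans ?_
      rw [Complex.norm_real, Real.norm_eq_abs, abs_mul, abs_two]
      have h2 := abs_le_br (μ := μ) ξ₀
      have h3 : c ≤ 1/16 := by rw [hc]; gcongr; exact min_le_right _ _
      nlinarith
    have e : ζ^2 - (ξ₀:ℂ)^2 = (ζ - ξ₀) * (ζ + ξ₀) := by ring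
    rw [norm_div, e, norm_mul, Complex.norm_real, Real.norm_eq_abs, abs_of_pos (by positivity : 0 < B^2),
      div_lt_iff₀ (by positivity)]
    have h5 : ‖ζ - ξ₀‖ * ‖ζ + ξ₀‖ ≤ (2 * (c * B)) * (4 * B) := by gcongr
    have h6 : (2 * (c * B)) * (4 * B) = min ε 1 / 2 * B^2 := by rw [hc]; ring
    rw [h6] at h5
    have : 0 < min ε 1 * B^2 := by positivity
    linarith
  have hG : 0 < B ^ (2*δ) := by positivity
  refine ⟨fun ζ => ((B ^ (2*δ) : ℝ) : ℂ) * (1 + (ζ^2 - (ξ₀:ℂ)^2) / ((B^2 : ℝ) : ℂ)) ^ (δ : ℂ), ?_, ?_, ?_⟩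
  · apply DifferentiableOn.const_mul
    apply DifferentiableOn.cpow (by fun_prop) (by fun_prop)
    intro ζ hζ
    exact Complex.mem_slitPlane_of_norm_lt_one ((hτ ζ hζ).trans_le (min_le_right _ _))
  · intro ζ hζ
    have h := hb ((hτ ζ hζ).trans_le (min_le_left _ _))
    set w := (1 + (ζ^2 - (ξ₀:ℂ)^2) / ((B^2 : ℝ) : ℂ)) ^ (δ : ℂ)
    constructor
    · rw [norm_mul, Complex.norm_real, Real.norm_eq_abs, abs_of_pos hG, mul_comm]
      gcongr
      have := norm_add_le (w - 1) 1
      simp at this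
      linarith
    · rw [Complex.re_ofReal_mul]
      have := (abs_le.1 (Complex.abs_re_le_norm (w-1))).1
      simp at this
      nlinarith
  · intro ξ hξ
    have h := (hτ ξ hξ).trans_le (min_le_right _ _)
    have e : ((ξ:ℂ)^2 - (ξ₀:ℂ)^2) / ((B^2 : ℝ) : ℂ) = (((ξ^2 - ξ₀^2)/B^2 : ℝ) : ℂ) := by push_cast; rfl
    rw [e, Complex.norm_real, Real.norm_eq_abs] at h
    have h0 : 0 ≤ 1 + (ξ^2 - ξ₀^2)/B^2 := by linarith [(abs_lt.1 h).1]
    simp only [e]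
    have e2 : (1:ℂ) + (((ξ^2 - ξ₀^2)/B^2 : ℝ) : ℂ) = ((1 + (ξ^2 - ξ₀^2)/B^2 : ℝ) : ℂ) := by push_cast; rfl
    rw [e2, ← Complex.ofReal_cpow h0, ← Complex.ofReal_mul]
    congr 1
    have e3 : ∀ y : ℝ, 0 ≤ y → y ^ (2*δ) = (y^2)^δ := fun y hy => by
      rw [Real.rpow_mul hy, Real.rpow_two]
    rw [e3 _ hB.le, e3 _ (br_pos hμ ξ).le, ← Real.mul_rpow (by positivity) h0]
    congr 1
    have : B^2 * (1 + (ξ^2 - ξ₀^2)/B^2) = B^2 + (ξ^2 - ξ₀^2) := by field_simp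
    rw [this, br_sq, br_sq]; ring

lemma final_num {s δ c c₂ B : ℝ} (hs : 1 < s) (hc : 0 < c) (hc₂ : 0 < c₂) (hB : 0 < B) (i j : ℕ) :
    (i.factorial : ℝ) * (2 * ((j.factorial : ℝ) /
      (c * B ^ (-δ) / (1 + ((i+j:ℕ):ℝ)^(s-1) * B^(-δ)))^j)) / (c₂ * B)^i ≤
    2 * (1/c + 1/c₂)^(i+j) * (((i+j:ℕ):ℝ) + ((i+j:ℕ):ℝ)^s * B^(-δ))^(i+j) * B^(-(i:ℝ) + δ * (j:ℝ)) := by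
  have hρ : 0 < B^(-δ) := by positivity
  have e1 : B^(-(i:ℝ) + δ * (j:ℝ)) = (B^i)⁻¹ * ((B^(-δ))^j)⁻¹ := by
    rw [Real.rpow_add hB, Real.rpow_neg hB.le, Real.rpow_natCast, Real.rpow_mul hB.le, Real.rpow_natCast,
      Real.rpow_neg hB.le, inv_pow, inv_inv]
  rw [e1]
  set ρ := B^(-δ)
  set N := i + j with hN
  set M := 1 + (N:ℝ)^(s-1) * ρ with hM
  have hM1 : 1 ≤ M := by have : 0 ≤ (N:ℝ)^(s-1) * ρ := by positivity
                         linarith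
  have e2 : ((N:ℝ) + (N:ℝ)^s * ρ) = N * M := by
    rcases Nat.eq_zero_or_pos N with h | h
    · rw [h]; simp [Real.zero_rpow (by linarith : s ≠ 0)]
    · have : (N:ℝ)^s = N * (N:ℝ)^(s-1) := by
        rw [mul_comm, ← Real.rpow_add_one (by positivity)]; congr 1; ring
      rw [this, hM]; ring
  rw [e2]
  have hf : (i.factorial : ℝ) * (j.factorial : ℝ) ≤ (N:ℝ)^N := by
    have h1 : i.factorial ≤ N^i := (Nat.factorial_le_pow i).trans (Nat.pow_le_pow_left (by omega) i)
    have h2 : j.factorial ≤ N^j := (Nat.factorial_le_pow j).trans (Nat.pow_le_pow_left (by omega) j)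
    have h3 : i.factorial * j.factorial ≤ N^N := by
      calc _ ≤ N^i * N^j := Nat.mul_le_mul h1 h2
        _ = N^N := by rw [← pow_add]
    exact_mod_cast h3
  calc _ = 2 * ((1/c)^j * (1/c₂)^i) * ((i.factorial : ℝ) * (j.factorial : ℝ) * M^j) * ((B^i)⁻¹ * (ρ^j)⁻¹) := by
        rw [div_pow, mul_pow, mul_pow, one_div, one_div, inv_pow, inv_pow]; field_simp
    _ ≤ 2 * ((1/c+1/c₂)^j * (1/c+1/c₂)^i) * ((N:ℝ)^N * M^N) * ((B^i)⁻¹ * (ρ^j)⁻¹) := by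
        gcongr
        · have : 0 < 1/c₂ := by positivity
          linarith
        · have : 0 < 1/c := by positivity
          linarith
        · omega
    _ = _ := by rw [mul_pow, hN, pow_add (1/c+1/c₂)]; ring

/-- real symbol as a function of `v` -/
noncomputable def hR (β b : ℝ → ℝ) (t y : ℝ) : ℝ :=
  Real.exp (-∫ σ in (0:ℝ)..t, β σ * (y / (b σ * y + 1)))

lemma exp_Lam (b a : ℝ → ℝ) (T δ t x : ℝ) {μ : ℝ} (hμ : 0 < μ) (ξ : ℝ) :
    Real.exp (-(Lam b a T δ μ t x ξ)) =
      hR (fun σ => |derivWithin b (Icc 0 T) σ|) b t (1 + a x * br μ ξ ^ (2*δ)) := by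
  unfold hR Lam
  congr 2
  apply intervalIntegral.integral_congr
  intro σ _
  have hB := br_pos hμ ξ
  have hG : 0 < br μ ξ ^ (2*δ) := by positivity
  simp only [phi]
  rw [Real.rpow_neg hB.le, mul_div_assoc]
  congr 1
  set G := br μ ξ ^ (2*δ)
  have e1 : a x + G⁻¹ = (1 + a x * G) * G⁻¹ := by field_simp; ring
  rw [e1]
  have e2 : b σ * ((1 + a x * G) * G⁻¹) + G⁻¹ = (b σ * (1 + a x * G) + 1) * G⁻¹ := by ring
  rw [e2, mul_div_mul_right _ _ (inv_ne_zero hG.ne')]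

lemma core {β b : ℝ → ℝ} {t : ℝ} (ht : 0 ≤ t) (hβ : ContinuousOn β (Icc 0 t))
    (hb : ContinuousOn b (Icc 0 t)) (hb0 : ∀ σ ∈ Icc 0 t, 0 ≤ b σ) (hβ0 : ∀ σ, 0 ≤ β σ)
    {a : ℝ → ℝ} (ha : ContDiff ℝ ∞ a) (ha0 : ∀ x, 0 ≤ a x) (x ξ₀ R r G : ℝ) (hR0 : 0 < R)
    (hr : 0 < r) (hG : 0 < G) (γ : ℝ → ℝ) (hγ : ∀ ξ, 0 < γ ξ) (g : ℂ → ℂ) (j : ℕ)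
    (hg : DifferentiableOn ℂ g (Metric.ball (ξ₀ : ℂ) (2 * R)))
    (hgb : ∀ ζ ∈ Metric.ball (ξ₀ : ℂ) (2 * R), ‖g ζ‖ ≤ 3/2 * G ∧ G / 2 ≤ (g ζ).re)
    (hgr : ∀ ξ : ℝ, (ξ : ℂ) ∈ Metric.ball (ξ₀ : ℂ) (2 * R) → g ξ = (γ ξ : ℂ))
    (hjet : jet j x r (fun y => a y - a x) ≤ (a x + G⁻¹) / 12) (i : ℕ) :
    |iteratedDeriv i (fun ξ => iteratedDeriv j (fun x' => hR β b t (1 + a x' * γ ξ)) x) ξ₀| ≤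
      (i.factorial : ℝ) * (2 * ((j.factorial : ℝ) / r^j)) / R^i := by
  set U : Set ℂ := {v : ℂ | 0 < v.re} with hU
  have hUo : IsOpen U := isOpen_lt continuous_const Complex.continuous_re
  have hHd : DifferentiableOn ℂ (HC β b t) U := HC_diff ht hβ hb hb0
  have hHr : ∀ y : ℝ, (y : ℂ) ∈ U → HC β b t y = ((hR β b t y : ℝ) : ℂ) := fun y _ => HC_real y
  set V := Metric.ball (ξ₀ : ℂ) (2 * R) with hV
  have hVo : IsOpen V := Metric.isOpen_ball
  set cf : ℕ → ℝ := fun k => iteratedDeriv j (fun y => (a y - a x)^k) x with hcf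
  set v : ℂ → ℂ := fun ζ => 1 + (a x : ℂ) * g ζ with hv
  have hax := ha0 x
  have hvre : ∀ ζ ∈ V, (1 + a x * G) / 2 ≤ (v ζ).re := by
    intro ζ hζ
    have h := (hgb ζ hζ).2
    simp only [hv, Complex.add_re, Complex.one_re, Complex.re_ofReal_mul]
    nlinarith
  have hv0 : 0 < 1 + a x * G := by positivity
  have hvU : MapsTo v V U := fun ζ hζ => by
    have := hvre ζ hζ
    show 0 < (v ζ).re
    linarith
  set D : ℂ → ℂ := fun ζ => ∑ k ∈ Finset.range (j+1),
    iteratedDeriv k (HC β b t) (v ζ) / (k.factorial : ℂ) * g ζ ^ k * (cf k : ℂ) with hD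
  have hDd : DifferentiableOn ℂ D V := by
    apply DifferentiableOn.fun_sum
    intro k _
    have h1 : DifferentiableOn ℂ (fun ζ => iteratedDeriv k (HC β b t) (v ζ)) V :=
      (cast_iter hUo hHd hHr k).1.comp ((hg.const_mul _).const_add _) hvU
    exact ((h1.div_const _).mul (hg.pow k)).mul_const _
  have hDr : ∀ ξ : ℝ, (ξ : ℂ) ∈ V → D ξ =
      ((iteratedDeriv j (fun x' => hR β b t (1 + a x' * γ ξ)) x : ℝ) : ℂ) := by
    intro ξ hξ
    have hgx := hγ ξ
    have hT := taylor_comp j (F := hR β b t) (f := fun x' => 1 + a x' * γ ξ) (t := Ioi 0) isOpen_Ioi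
      (fun y hy => (cast_contDiffAt hUo hHd hHr y (by simpa [hU] using hy) j).contDiffWithinAt)
      (by fun_prop) (by
        rintro _ ⟨y, rfl⟩
        have := ha0 y
        show 0 < 1 + a y * γ ξ
        positivity) x
    rw [hT, Complex.ofReal_sum]
    refine Finset.sum_congr rfl fun k _ => ?_
    have e1 : v ξ = ((1 + a x * γ ξ : ℝ) : ℂ) := by
      simp only [hv]; rw [hgr ξ hξ]; push_cast; rfl
    have e2 : (fun y => (1 + a y * γ ξ - (1 + a x * γ ξ))^k) = fun y => (γ ξ)^k * (a y - a x)^k := by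
      ext y; rw [← mul_pow]; congr 1; ring
    rw [e2, iteratedDeriv_const_mul_field, e1, (cast_iter hUo hHd hHr k).2 _ (by
      show 0 < ((1 + a x * γ ξ : ℝ) : ℂ).re
      rw [Complex.ofReal_re]; positivity), hgr ξ hξ]
    push_cast
    simp only [hcf]
    ring
  have hDb : ∀ ζ ∈ V, ‖D ζ‖ ≤ 2 * ((j.factorial : ℝ) / r^j) := by
    intro ζ hζ
    have hcfb : ∀ k, |cf k| ≤ (j.factorial : ℝ) / r^j * ((a x + G⁻¹)/12)^k := by
      intro k
      have h1 := iter_le_jet j x r hr.le (fun y => (a y - a x)^k)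
      have h2 := jet_pow j x r hr.le (fun y => a y - a x) (by fun_prop) k
      have h3 : jet j x r (fun y => a y - a x) ^ k ≤ ((a x + G⁻¹)/12)^k :=
        pow_le_pow_left₀ (jet_nonneg _ _ _ hr.le _) hjet k
      have h4 := (h1.trans h2).trans h3
      rw [div_le_iff₀ (by positivity)] at h4
      rw [div_mul_eq_mul_div, le_div_iff₀ (by positivity)]
      linarith
    have hHb : ∀ k, ‖iteratedDeriv k (HC β b t) (v ζ)‖ ≤ (k.factorial : ℝ) * 1 / ((1 + a x * G)/4)^k := by
      intro k
      have hsub : Metric.closedBall (v ζ) ((1 + a x * G)/4) ⊆ U := by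
        intro w hw
        rw [mem_closedBall_iff_norm] at hw
        have h1 := (abs_le.1 (Complex.abs_re_le_norm (w - v ζ))).1
        have h2 := hvre ζ hζ
        rw [Complex.sub_re] at h1
        show 0 < w.re
        linarith
      apply Complex.norm_iteratedDeriv_le_of_forall_mem_sphere_norm_le k (by positivity)
      · exact (hHd.mono hsub).diffContOnCl_ball le_rfl
      · intro z hz
        exact HC_norm ht hβ hb hb0 hβ0 (hsub (Metric.sphere_subset_closedBall hz))
    calc ‖D ζ‖ ≤ ∑ k ∈ Finset.range (j+1), (j.factorial : ℝ) / r^j * (1/2)^k := by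
          refine norm_sum_le_of_le _ fun k _ => ?_
          rw [norm_mul, norm_mul, norm_div, norm_pow, Complex.norm_real, Real.norm_eq_abs, Complex.norm_natCast]
          have hgz := (hgb ζ hζ).1
          calc _ ≤ ((k.factorial : ℝ) * 1 / ((1 + a x * G)/4)^k) / (k.factorial : ℝ) * (3/2*G)^k *
                ((j.factorial : ℝ) / r^j * ((a x + G⁻¹)/12)^k) := by
                gcongr
                · exact hHb k
                · exact hcfb k
            _ = (j.factorial : ℝ) / r^j * (((1 + a x * G)/4)⁻¹ * (3/2*G) * ((a x + G⁻¹)/12))^k := by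
                rw [mul_pow (((1 + a x * G)/4)⁻¹ * (3/2*G)), mul_pow ((1 + a x * G)/4)⁻¹, inv_pow]
                have hk : (k.factorial : ℝ) ≠ 0 := by positivity
                generalize ((1 + a x * G)/4)^k = X
                generalize (3/2*G)^k = Y
                generalize ((a x + G⁻¹)/12)^k = Z
                have e : (k.factorial : ℝ) * 1 / X / (k.factorial : ℝ) = X⁻¹ := by
                  rw [mul_one, div_div, mul_comm X, ← div_div, div_self hk, one_div]
                rw [e]; ring
            _ = _ := by
                congr 2
                have : a x + G⁻¹ = (1 + a x * G) * G⁻¹ := by field_simp; ring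
                rw [this]; field_simp; norm_num
      _ = (j.factorial : ℝ) / r^j * ∑ k ∈ Finset.range (j+1), (1/2:ℝ)^k := by rw [Finset.mul_sum]
      _ ≤ (j.factorial : ℝ) / r^j * 2 := by
          gcongr; exact geo_le (by norm_num) le_rfl _
      _ = _ := by ring
  have hmem : (ξ₀ : ℂ) ∈ V := Metric.mem_ball_self (by positivity)
  have hfin := (cast_iter hVo hDd hDr i).2 ξ₀ hmem
  rw [← Real.norm_eq_abs, ← Complex.norm_real, ← hfin]
  have hsub : Metric.closedBall (ξ₀ : ℂ) R ⊆ V := Metric.closedBall_subset_ball (by linarith)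
  apply Complex.norm_iteratedDeriv_le_of_forall_mem_sphere_norm_le i hR0
  · exact (hDd.mono hsub).diffContOnCl_ball le_rfl
  · exact fun z hz => hDb z (hsub (Metric.sphere_subset_closedBall hz))

theorem stmt16 (T : ℝ) (hT : 0 < T)
    (b : ℝ → ℝ) (hb : ContDiffOn ℝ 1 b (Icc 0 T)) (hb0 : ∀ t ∈ Icc (0:ℝ) T, 0 ≤ b t)
    (s δ : ℝ) (hs : 1 < s) (hδ0 : 0 ≤ δ) (hδ1 : δ < 1)
    (a : ℝ → ℝ) (ha : Gevrey s a) (ha0 : ∀ x, 0 ≤ a x) :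
    ∃ A C : ℝ, 0 < A ∧ 0 < C ∧
      ∀ (i j : ℕ) (μ t x ξ : ℝ), 0 < μ → μ ≤ 1 → t ∈ Icc (0:ℝ) T →
        |pdXiX i j (fun x' ξ' => Real.exp (-(Lam b a T δ μ t x' ξ'))) x ξ| ≤
          C * A ^ (i + j) *
            (((i + j : ℕ) : ℝ) + ((i + j : ℕ) : ℝ) ^ s * br μ ξ ^ (-δ)) ^ (i + j) *
            br μ ξ ^ (-(i : ℝ) + δ * (j : ℝ)) := by
  obtain ⟨c, hc, hjet⟩ := jet_gevrey hs ha ha0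
  obtain ⟨c₂, hc₂, hg⟩ := gext δ
  refine ⟨1/c + 1/c₂, 2, by positivity, by norm_num, ?_⟩
  intro i j μ t x ξ hμ _ ht
  have hsub : Icc 0 t ⊆ Icc 0 T := Icc_subset_Icc_right ht.2
  obtain ⟨g, hgd, hgb, hgr⟩ := hg μ ξ hμ
  have hB := br_pos hμ ξ
  have hρ : 0 < br μ ξ ^ (-δ) := by positivity
  have hM : 0 < 1 + ((i+j:ℕ):ℝ)^(s-1) * br μ ξ ^ (-δ) := by positivity
  refine le_trans ?_ (final_num (c := c) (c₂ := c₂) (B := br μ ξ) (δ := δ) hs hc hc₂ hB i j)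
  unfold pdXiX
  simp only [exp_Lam b a T δ t _ hμ]
  refine core ht.1 (((hb.continuousOn_derivWithin (uniqueDiffOn_Icc hT) le_rfl).abs).mono hsub)
    (hb.continuousOn.mono hsub) (fun σ hσ => hb0 σ (hsub hσ)) (fun σ => abs_nonneg _) ha.1 ha0 x ξ
    (c₂ * br μ ξ) _ (br μ ξ ^ (2*δ)) (by positivity) (by positivity) (by positivity)
    (fun ξ => br μ ξ ^ (2*δ)) (fun ξ => Real.rpow_pos_of_pos (br_pos hμ ξ) _) g j hgd hgb hgr ?_ i
  have h := hjet j (i+j) x (br μ ξ ^ (-δ)) (by omega) hρ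
  have e : (br μ ξ ^ (-δ))^2 = (br μ ξ ^ (2*δ))⁻¹ := by
    rw [← Real.rpow_neg hB.le, ← Real.rpow_natCast, ← Real.rpow_mul hB.le]
    congr 1; push_cast; ring
  rwa [e] at h
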